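/- Let C = ⟨(b(x) | 0), (ℓ(x) | a(x))⟩ be a Z₂-double cyclic code with b(x) | x^r−1, a(x) | x^s−1, and a(x) generating C_s. Let T = { (0 | p(x)) ∈ C^⊥ }. Then T equals the Z₂[x]-submodule generated by (0 | (x^s−1)/a*(x)). -/

import Mathlib

open Polynomial

noncomputable section

/-- The polynomial ring `Z₂[x]`. -/
abbrev Z2P : Type := Polynomial (ZMod 2)

/-- The quotient ring `Z₂[x]/(x^n - 1)`. -/
abbrev Rq (n : ℕ) : Type := Z2P ⧸ Ideal.span {(X : Z2P) ^ n - 1}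

/-- The canonical projection `Z₂[x] → Z₂[x]/(x^n - 1)`. -/
def mkQ (n : ℕ) : Z2P →+* Rq n := Ideal.Quotient.mk _

/-- The element of `Z₂[x]/(x^n − 1)` associated to a vector `v ∈ Z₂^n` via coefficients. -/
def ofVec (n : ℕ) (v : Fin n → ZMod 2) : Rq n :=
  mkQ n (∑ i : Fin n, Polynomial.C (v i) * (X : Z2P) ^ (i : ℕ))

/-- The dual code `C^⊥` of a `Z₂`-double cyclic code `C ⊆ R_{r,s}`, computed with respect to
the standard inner product on `Z₂^{r+s}` under the coefficient identification
`R_{r,s} ≅ Z₂^r × Z₂^s`. -/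
def dualCode (r s : ℕ) (C : Submodule Z2P (Rq r × Rq s)) : Set (Rq r × Rq s) :=
  {c | ∃ w : (Fin r → ZMod 2) × (Fin s → ZMod 2),
        (ofVec r w.1, ofVec s w.2) = c ∧
        ∀ u : (Fin r → ZMod 2) × (Fin s → ZMod 2),
          (ofVec r u.1, ofVec s u.2) ∈ C →
          (∑ i, u.1 i * w.1 i) + (∑ j, u.2 j * w.2 j) = 0}

/-- The polynomial with coefficient vector `v`. -/
def vecPoly (n : ℕ) (v : Fin n → ZMod 2) : Z2P :=
  ∑ i : Fin n, Polynomial.C (v i) * (X : Z2P) ^ (i : ℕ)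

/-- A polynomial representing `v(x⁻¹)` modulo `x^n - 1`. -/
def vecPolyInv (n : ℕ) (v : Fin n → ZMod 2) : Z2P :=
  ∑ i : Fin n, Polynomial.C (v i) * (X : Z2P) ^ (n - (i : ℕ))

/-- The constant coefficient of the reduction of a polynomial modulo `x^n - 1`. -/
def cyclicTrace (n : ℕ) : Z2P →ₗ[ZMod 2] ZMod 2 :=
  Polynomial.lsum fun i => if n ∣ i then LinearMap.id else 0

lemma cyclicTrace_C_mul_X_pow (n : ℕ) (c : ZMod 2) (k : ℕ) :
    cyclicTrace n (Polynomial.C c * X ^ k) = if n ∣ k then c else 0 := by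
  rw [cyclicTrace, Polynomial.lsum_apply, C_mul_X_pow_eq_monomial, sum_monomial_index]
  · split_ifs <;> simp
  · simp

lemma mkQ_eq_zero_iff (n : ℕ) (p : Z2P) : mkQ n p = 0 ↔ (X : Z2P) ^ n - 1 ∣ p := by
  rw [mkQ, Ideal.Quotient.eq_zero_iff_mem, Ideal.mem_span_singleton]

lemma smul_mkQ (n : ℕ) (p q : Z2P) : p • mkQ n q = mkQ n (p * q) := rfl

lemma mkQ_surjective (n : ℕ) : Function.Surjective (mkQ n) := Ideal.Quotient.mk_surjective

lemma mem_span_mkQ_iff (n : ℕ) (a : Z2P) (z : Rq n) :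
    z ∈ Submodule.span Z2P {mkQ n a} ↔ ∃ p, mkQ n (p * a) = z := by
  simp [Submodule.mem_span_singleton, smul_mkQ]

lemma cyclicTrace_mul_sub_one (n : ℕ) (p : Z2P) :
    cyclicTrace n (((X : Z2P) ^ n - 1) * p) = 0 := by
  induction p using Polynomial.induction_on' with
  | add p q hp hq => rw [mul_add, map_add, hp, hq, add_zero]
  | monomial k c =>
    have h : ((X : Z2P) ^ n - 1) * monomial k c
        = Polynomial.C c * X ^ (k + n) - Polynomial.C c * X ^ k := by
      rw [← C_mul_X_pow_eq_monomial]; ring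
    rw [h, map_sub, cyclicTrace_C_mul_X_pow, cyclicTrace_C_mul_X_pow]
    simp

lemma cyclicTrace_congr {n : ℕ} {p q : Z2P} (h : mkQ n p = mkQ n q) :
    cyclicTrace n p = cyclicTrace n q := by
  rw [← sub_eq_zero, ← map_sub, mkQ_eq_zero_iff] at h
  obtain ⟨t, ht⟩ := h
  rw [← sub_eq_zero, ← map_sub, ht, cyclicTrace_mul_sub_one]

lemma dvd_add_sub_iff {n : ℕ} (i j : Fin n) : n ∣ (i : ℕ) + (n - (j : ℕ)) ↔ i = j := by
  have hi := i.2
  have hj := j.2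
  rw [Fin.ext_iff]
  constructor
  · rintro ⟨k, hk⟩
    have h1 : 0 < k := by
      rcases Nat.eq_zero_or_pos k with rfl | h
      · omega
      · exact h
    have h2 : k < 2 := by
      by_contra! h
      have := Nat.mul_le_mul_left n h
      omega
    obtain rfl : k = 1 := by omega
    omega
  · intro h
    exact ⟨1, by omega⟩

lemma cyclicTrace_vecPoly_mul_vecPolyInv (n : ℕ) (u w : Fin n → ZMod 2) :
    cyclicTrace n (vecPoly n u * vecPolyInv n w) = ∑ i, u i * w i := by
  have h (i j : Fin n) : Polynomial.C (u i) * (X : Z2P) ^ (i : ℕ) *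
      (Polynomial.C (w j) * X ^ (n - (j : ℕ)))
      = Polynomial.C (u i * w j) * X ^ ((i : ℕ) + (n - (j : ℕ))) := by
    rw [C_mul, pow_add]; ring
  simp only [vecPoly, vecPolyInv, Finset.sum_mul_sum, h, map_sum, cyclicTrace_C_mul_X_pow,
    dvd_add_sub_iff]
  simp

lemma mkQ_vecPoly (n : ℕ) (v : Fin n → ZMod 2) : mkQ n (vecPoly n v) = ofVec n v := rfl

lemma ofVec_surjective {n : ℕ} (hn : 0 < n) : Function.Surjective (ofVec n) := by
  intro z
  obtain ⟨p, rfl⟩ := mkQ_surjective n z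
  have hm : ((X : Z2P) ^ n - 1).Monic := monic_X_pow_sub_C 1 hn.ne'
  have hd : (p %ₘ ((X : Z2P) ^ n - 1)).degree < n := by
    have h := degree_modByMonic_lt p hm
    rwa [show ((X : Z2P) ^ n - 1).degree = n from degree_X_pow_sub_C hn 1] at h
  refine ⟨fun i => (p %ₘ ((X : Z2P) ^ n - 1)).coeff i, ?_⟩
  rw [ofVec, Fin.sum_univ_eq_sum_range
    (fun i => Polynomial.C ((p %ₘ ((X : Z2P) ^ n - 1)).coeff i) * (X : Z2P) ^ i) n]
  have hs : (p %ₘ ((X : Z2P) ^ n - 1)) = ∑ i ∈ Finset.range n,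
      Polynomial.C ((p %ₘ ((X : Z2P) ^ n - 1)).coeff i) * (X : Z2P) ^ i := by
    refine as_sum_range_C_mul_X_pow' _ ?_
    rcases eq_or_ne (p %ₘ ((X : Z2P) ^ n - 1)) 0 with h0 | h0
    · rw [h0]; simpa using hn
    · exact (natDegree_lt_iff_degree_lt h0).2 hd
  rw [← hs, ← sub_eq_zero, ← map_sub, mkQ_eq_zero_iff]
  refine ⟨-(p /ₘ ((X : Z2P) ^ n - 1)), ?_⟩
  linear_combination modByMonic_add_div p ((X : Z2P) ^ n - 1)

lemma eq_zero_of_cyclicTrace_vecPolyInv {n : ℕ} {v : Fin n → ZMod 2}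
    (h : ∀ w, cyclicTrace n (vecPoly n v * vecPolyInv n w) = 0) : v = 0 := by
  ext i
  simpa [cyclicTrace_vecPoly_mul_vecPolyInv, Pi.single_apply] using h (Pi.single i 1)

lemma eq_zero_of_ofVec_eq_zero {n : ℕ} {v : Fin n → ZMod 2} (h : ofVec n v = 0) : v = 0 := by
  refine eq_zero_of_cyclicTrace_vecPolyInv fun w => ?_
  rw [← map_zero (cyclicTrace n)]
  refine cyclicTrace_congr ?_
  rw [map_mul, mkQ_vecPoly, h, zero_mul, map_zero]

/-- The trace form on `Z₂[x]/(x^n - 1)` is nondegenerate. -/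
lemma mkQ_eq_zero_of_cyclicTrace {n : ℕ} (hn : 0 < n) {f : Z2P}
    (h : ∀ p, cyclicTrace n (p * f) = 0) : mkQ n f = 0 := by
  obtain ⟨v, hv⟩ := ofVec_surjective hn (mkQ n f)
  rw [← mkQ_vecPoly] at hv
  have hv0 : v = 0 := eq_zero_of_cyclicTrace_vecPolyInv fun w => by
    rw [← h (vecPolyInv n w)]
    refine cyclicTrace_congr ?_
    rw [map_mul, map_mul, hv, mul_comm]
  rw [← hv, hv0]
  simp [vecPoly]

lemma mkQ_X_pow_self (n : ℕ) : mkQ n X ^ n = 1 := by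
  rw [← sub_eq_zero, ← map_pow, ← map_one (mkQ n), ← map_sub, mkQ_eq_zero_iff]

/-- The class of `x` is a unit in `Z₂[x]/(x^n - 1)`. -/
abbrev mkQXInvertible {n : ℕ} (hn : 0 < n) : Invertible (mkQ n X) :=
  Invertible.mk (mkQ n X ^ (n - 1))
    (by rw [← pow_succ, Nat.sub_add_cancel hn, mkQ_X_pow_self])
    (by rw [← pow_succ', Nat.sub_add_cancel hn, mkQ_X_pow_self])

/-- The substitution `x ↦ x⁻¹`, with values in `Z₂[x]/(x^n - 1)`. -/
def invSubst (n : ℕ) : Z2P →+* Rq n :=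
  Polynomial.eval₂RingHom ((mkQ n).comp Polynomial.C) (mkQ n X ^ (n - 1))

lemma eval₂_mkQ_X (n : ℕ) (p : Z2P) :
    p.eval₂ ((mkQ n).comp Polynomial.C) (mkQ n X) = mkQ n p := by
  rw [← Polynomial.hom_eval₂, Polynomial.eval₂_C_X]

lemma invSubst_reverse {n : ℕ} (hn : 0 < n) (p : Z2P) :
    invSubst n p.reverse * mkQ n X ^ p.natDegree = mkQ n p := by
  let := mkQXInvertible hn
  have h := Polynomial.eval₂_reverse_mul_pow ((mkQ n).comp Polynomial.C) (mkQ n X) p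
  rwa [eval₂_mkQ_X] at h

lemma mkQ_reverse {n : ℕ} (hn : 0 < n) (p : Z2P) :
    mkQ n p.reverse = invSubst n p * mkQ n X ^ p.natDegree := by
  let := mkQXInvertible hn
  let : Invertible (mkQ n X ^ (n - 1)) := invertibleInvOf (a := mkQ n X)
  have h := Polynomial.eval₂_reverse_mul_pow ((mkQ n).comp Polynomial.C) (mkQ n X ^ (n - 1)) p
  have hi : ⅟(mkQ n X ^ (n - 1)) = mkQ n X := rfl
  have h1 : mkQ n X ^ (n - 1) * mkQ n X = 1 := by
    rw [← pow_succ, Nat.sub_add_cancel hn, mkQ_X_pow_self]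
  rw [hi, eval₂_mkQ_X] at h
  rw [invSubst, Polynomial.coe_eval₂RingHom, ← h, mul_assoc, ← mul_pow, h1, one_pow, mul_one]

lemma invSubst_eq_zero {n : ℕ} {p : Z2P} (h : mkQ n p = 0) : invSubst n p = 0 := by
  obtain ⟨t, rfl⟩ := (mkQ_eq_zero_iff n p).1 h
  rw [map_mul, map_sub, map_pow, invSubst]
  simp only [coe_eval₂RingHom, eval₂_X, map_one]
  rw [← pow_mul, mul_comm (n - 1), pow_mul, mkQ_X_pow_self]
  simp

lemma isUnit_mkQ_X {n : ℕ} (hn : 0 < n) : IsUnit (mkQ n X) :=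
  let := mkQXInvertible hn
  isUnit_of_invertible _

lemma invSubst_vecPoly {n : ℕ} (w : Fin n → ZMod 2) :
    invSubst n (vecPoly n w) = mkQ n (vecPolyInv n w) := by
  simp only [vecPoly, vecPolyInv, map_sum, map_mul, map_pow]
  refine Finset.sum_congr rfl fun i _ => ?_
  simp only [invSubst, coe_eval₂RingHom, eval₂_C, eval₂_X, RingHom.comp_apply]
  congr 1
  have hi := i.2
  have hn : 0 < n := by omega
  refine ((isUnit_mkQ_X hn).pow (i : ℕ)).mul_right_cancel ?_
  rw [← mul_pow, ← pow_succ, Nat.sub_add_cancel hn, ← pow_add, Nat.sub_add_cancel hi.le,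
    mkQ_X_pow_self, one_pow]

lemma invSubst_vecPolyInv {n : ℕ} (w : Fin n → ZMod 2) :
    invSubst n (vecPolyInv n w) = mkQ n (vecPoly n w) := by
  simp only [vecPoly, vecPolyInv, map_sum, map_mul, map_pow]
  refine Finset.sum_congr rfl fun i _ => ?_
  simp only [invSubst, coe_eval₂RingHom, eval₂_C, eval₂_X, RingHom.comp_apply]
  congr 1
  have hi := i.2
  have hn : 0 < n := by omega
  refine ((isUnit_mkQ_X hn).pow (n - (i : ℕ))).mul_right_cancel ?_
  rw [← mul_pow, ← pow_succ, Nat.sub_add_cancel hn, ← pow_add, Nat.add_sub_cancel' hi.le,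
    mkQ_X_pow_self, one_pow]

lemma mkQ_mul_vecPolyInv_eq_zero_iff {n : ℕ} (hn : 0 < n) (a : Z2P) (w : Fin n → ZMod 2) :
    mkQ n (a * vecPolyInv n w) = 0 ↔ mkQ n (a.reverse * vecPoly n w) = 0 := by
  constructor
  · intro h
    have h1 := invSubst_eq_zero h
    rw [map_mul, invSubst_vecPolyInv] at h1
    rw [map_mul, mkQ_reverse hn, mul_right_comm, h1, zero_mul]
  · intro h
    have h1 := invSubst_eq_zero h
    rw [map_mul, invSubst_vecPoly] at h1
    rw [map_mul, ← invSubst_reverse hn, mul_right_comm, h1, zero_mul]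

lemma reverse_X_pow_sub_one (n : ℕ) :
    ((X : Z2P) ^ n - 1).reverse = -(X ^ n - 1) := by
  have hd : ((X : Z2P) ^ n - 1).natDegree = n := natDegree_X_pow_sub_C (r := 1)
  have h1 : reflect n (1 : Z2P) = X ^ n := by
    simp
  have h2 : reflect n ((X : Z2P) ^ n) = 1 := by
    rw [reflect_monomial, revAt_le le_rfl, Nat.sub_self, pow_zero]
  rw [reverse, hd, reflect_sub, h1, h2, neg_sub]

lemma reverse_dvd_X_pow_sub_one {n : ℕ} {a : Z2P} (ha : a ∣ (X : Z2P) ^ n - 1) :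
    a.reverse ∣ (X : Z2P) ^ n - 1 := by
  obtain ⟨h, hh⟩ := ha
  rw [← dvd_neg, ← reverse_X_pow_sub_one, hh, reverse_mul_of_domain]
  exact dvd_mul_right _ _

lemma mkQ_mul_eq_zero_iff_mem_span {n : ℕ} (hn : 0 < n) {d : Z2P} (hd : d ∣ (X : Z2P) ^ n - 1)
    (p : Z2P) :
    mkQ n (d * p) = 0 ↔ mkQ n p ∈ Submodule.span Z2P {mkQ n (((X : Z2P) ^ n - 1) / d)} := by
  have hq : (X : Z2P) ^ n - 1 ≠ 0 := (monic_X_pow_sub_C 1 hn.ne').ne_zero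
  have hd0 : d ≠ 0 := fun h => hq (by rw [h] at hd; exact zero_dvd_iff.1 hd)
  have hdq : d * (((X : Z2P) ^ n - 1) / d) = X ^ n - 1 := EuclideanDomain.mul_div_cancel' hd0 hd
  rw [mkQ_eq_zero_iff, mem_span_mkQ_iff]
  generalize ((X : Z2P) ^ n - 1) / d = e at hdq ⊢
  constructor
  · intro h
    rw [← hdq, mul_dvd_mul_iff_left hd0] at h
    obtain ⟨t, rfl⟩ := h
    exact ⟨t, by rw [mul_comm]⟩
  · rintro ⟨t, ht⟩
    rw [← sub_eq_zero, ← map_sub, mkQ_eq_zero_iff, ← hdq] at ht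
    rw [← hdq, mul_dvd_mul_iff_left hd0]
    exact (dvd_sub_right (dvd_mul_left e t)).1 ((dvd_mul_left e d).trans ht)

/-- The dual of the cyclic code generated by a divisor `a` of `x^n - 1` is generated by
`(x^n - 1) / a*`. -/
lemma forall_dot_eq_zero_iff_ofVec_mem_span {n : ℕ} (hn : 0 < n) {a : Z2P}
    (ha : a ∣ (X : Z2P) ^ n - 1) (w : Fin n → ZMod 2) :
    (∀ u, ofVec n u ∈ Submodule.span Z2P {mkQ n a} → ∑ i, u i * w i = 0) ↔
      ofVec n w ∈ Submodule.span Z2P {mkQ n (((X : Z2P) ^ n - 1) / a.reverse)} := by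
  rw [← mkQ_vecPoly n w, ← mkQ_mul_eq_zero_iff_mem_span hn (reverse_dvd_X_pow_sub_one ha),
    ← mkQ_mul_vecPolyInv_eq_zero_iff hn]
  simp only [← cyclicTrace_vecPoly_mul_vecPolyInv, mem_span_mkQ_iff, ← mkQ_vecPoly]
  constructor
  · intro h
    refine mkQ_eq_zero_of_cyclicTrace hn fun p => ?_
    obtain ⟨u, hu⟩ := ofVec_surjective hn (mkQ n (p * a))
    rw [← mkQ_vecPoly] at hu
    rw [← h u ⟨p, hu.symm⟩]
    refine cyclicTrace_congr ?_
    rw [← mul_assoc, map_mul, ← hu, map_mul]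
  · rintro h u ⟨p, hp⟩
    rw [← map_zero (cyclicTrace n)]
    refine cyclicTrace_congr ?_
    rw [map_mul, ← hp, ← map_mul, mul_assoc, map_mul, h, mul_zero, map_zero]

lemma mem_span_zero_prod_iff (r s : ℕ) (z : Rq s) (c : Rq r × Rq s) :
    c ∈ Submodule.span Z2P {((0 : Rq r), z)} ↔ c.1 = 0 ∧ c.2 ∈ Submodule.span Z2P {z} := by
  obtain ⟨c₁, c₂⟩ := c
  simp only [Submodule.mem_span_singleton, Prod.smul_mk, smul_zero, Prod.mk.injEq]
  constructor
  · rintro ⟨p, h₁, h₂⟩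
    exact ⟨h₁.symm, p, h₂⟩
  · rintro ⟨h₁, p, h₂⟩
    exact ⟨p, h₁.symm, h₂⟩

/-- Let `C = ⟨(b | 0), (ℓ | a)⟩` with `b ∣ x^r−1`, `a ∣ x^s−1` and `a` generating `C_s`, and
let `T = {(0 | p) ∈ C^⊥}`. Then `T = ⟨(0 | (x^s−1)/a*)⟩`, where `a* = reverse a`. -/
theorem stmt15 (r s : ℕ) (hr : 0 < r) (hs : 0 < s) (b l a : Z2P)
    (C : Submodule Z2P (Rq r × Rq s))
    (hCdef : C = Submodule.span Z2P {((mkQ r b, 0) : Rq r × Rq s), (mkQ r l, mkQ s a)})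
    (hb : b ∣ (X : Z2P) ^ r - 1) (ha : a ∣ (X : Z2P) ^ s - 1)
    (hCs : Submodule.map (LinearMap.snd Z2P (Rq r) (Rq s)) C =
      Submodule.span Z2P {mkQ s a}) :
    {c : Rq r × Rq s | c ∈ dualCode r s C ∧ c.1 = 0} =
      (Submodule.span Z2P
          {(((0 : Rq r), mkQ s (((X : Z2P) ^ s - 1) / a.reverse)) : Rq r × Rq s)} :
        Set (Rq r × Rq s)) := by
  ext c
  rw [SetLike.mem_coe, mem_span_zero_prod_iff, Set.mem_ofPred_eq, and_comm]
  refine and_congr_right fun hc => ?_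
  have hC (z : Rq s) : z ∈ Submodule.span Z2P {mkQ s a} ↔ ∃ y, (y, z) ∈ C := by
    rw [← hCs]
    simp
  constructor
  · rintro ⟨w, rfl, hw⟩
    have hw₁ : w.1 = 0 := eq_zero_of_ofVec_eq_zero hc
    refine (forall_dot_eq_zero_iff_ofVec_mem_span hs ha w.2).1 fun u hu => ?_
    obtain ⟨y, hy⟩ := (hC _).1 hu
    obtain ⟨v, rfl⟩ := ofVec_surjective hr y
    simpa [hw₁] using hw (v, u) hy
  · intro h
    obtain ⟨w, hw⟩ := ofVec_surjective hs c.2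
    rw [← hw, ← forall_dot_eq_zero_iff_ofVec_mem_span hs ha] at h
    refine ⟨(0, w), Prod.ext ?_ hw, fun u hu => ?_⟩
    · rw [hc]
      simp [ofVec]
    · simpa using h u.2 ((hC _).2 ⟨_, hu⟩)
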